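/- arXiv:1308.2609 — 2 statements merged into one kernel-verified Lean document; each statement's English description precedes it below -/
import Mathlib

section
/- Let V be an N-dimensional complex inner product space and let K be a linear operator on V having N distinct eigenvalues. If x ≠ 0 satisfies K x = κ x and y ≠ 0 satisfies K† y = conj(κ) y, then ⟪y, x⟫ ≠ 0. -/
open scoped InnerProductSpace ComplexConjugate

/-- If `K`, an operator on an `N`-dimensional complex inner product space,
has `N` distinct eigenvalues (its spectrum is the range of an injective map
`Fin N → ℂ`), and `x ≠ 0`, `y ≠ 0` satisfy `K x = κ • x`, `K† y = conj κ • y`,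
then `⟪y, x⟫ ≠ 0`. -/
theorem stmt2 {V : Type*} [NormedAddCommGroup V] [InnerProductSpace ℂ V]
    [FiniteDimensional ℂ V]
    (K : V →ₗ[ℂ] V)
    (hspec : ∃ κs : Fin (Module.finrank ℂ V) → ℂ,
      Function.Injective κs ∧ spectrum ℂ K = Set.range κs)
    (x y : V) (κ : ℂ) (hx0 : x ≠ 0) (hy0 : y ≠ 0)
    (hx : K x = κ • x) (hy : LinearMap.adjoint K y = (starRingEnd ℂ) κ • y) :
    ⟪y, x⟫_ℂ ≠ 0 := by
  obtain ⟨κs, hinj, hs⟩ := hspec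
  intro h0
  have hκ : κ ∈ spectrum ℂ K :=
    (Module.End.hasEigenvalue_of_hasEigenvector
      (Module.End.hasEigenvector_iff.2 ⟨Module.End.mem_eigenspace_iff.2 hx, hx0⟩)).mem_spectrum
  rw [hs] at hκ
  obtain ⟨i0, rfl⟩ := hκ
  have hv : ∀ i, ∃ v : V, Module.End.HasEigenvector K (κs i) v ∧ ⟪y, v⟫_ℂ = 0 := by
    intro i
    by_cases hi : i = i0
    · subst hi
      exact ⟨x, Module.End.hasEigenvector_iff.2 ⟨Module.End.mem_eigenspace_iff.2 hx, hx0⟩, h0⟩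
    · have hm : κs i ∈ spectrum ℂ K := hs ▸ Set.mem_range_self i
      obtain ⟨v, hv⟩ := (Module.End.hasEigenvalue_iff_mem_spectrum.2 hm).exists_hasEigenvector
      refine ⟨v, hv, ?_⟩
      have h1 := LinearMap.adjoint_inner_left K v y
      rw [hy, hv.apply_eq_smul, inner_smul_left, inner_smul_right, Complex.conj_conj] at h1
      have h2 : (κs i0 - κs i) * ⟪y, v⟫_ℂ = 0 := by rw [sub_mul, h1, sub_self]
      rcases mul_eq_zero.1 h2 with h3 | h3
      · exact absurd (hinj (sub_eq_zero.1 h3)).symm hi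
      · exact h3
  choose v hv hv0 using hv
  have hli := Module.End.eigenvectors_linearIndependent' K κs hinj v hv
  have hspan : Submodule.span ℂ (Set.range v) = ⊤ :=
    hli.span_eq_top_of_card_eq_finrank' (by simp)
  have hle : Submodule.span ℂ (Set.range v) ≤ LinearMap.ker (innerₛₗ ℂ y) := by
    rw [Submodule.span_le]
    rintro _ ⟨i, rfl⟩
    simpa using hv0 i
  have hy' : y ∈ LinearMap.ker (innerₛₗ ℂ y) := hle (hspan ▸ Submodule.mem_top)
  apply hy0
  simpa using hy'
end

section
/- Let γ be a real number with γ² < 1 and define the deformed Pauli matrices σ_x^γ = (1−γ²)^{−1/2} [[−iγ, 1], [1, iγ]], σ_y^γ = [[0, −i], [i, 0]], σ_z^γ = (1−γ²)^{−1/2} [[1, iγ], [iγ, −1]] (2×2 complex matrices). Then they satisfy the su(2) commutation relations: [σ_x^γ, σ_y^γ] = 2i σ_z^γ, [σ_y^γ, σ_z^γ] = 2i σ_x^γ, and [σ_z^γ, σ_x^γ] = 2i σ_y^γ. -/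
/-- For real `γ` with `γ² < 1`, the deformed Pauli matrices
`σ_x^γ = (1−γ²)^{-1/2} [[−iγ, 1], [1, iγ]]`, `σ_y^γ = [[0, −i], [i, 0]]`,
`σ_z^γ = (1−γ²)^{-1/2} [[1, iγ], [iγ, −1]]` satisfy the `su(2)` commutation
relations `[σ_x, σ_y] = 2i σ_z`, `[σ_y, σ_z] = 2i σ_x`, `[σ_z, σ_x] = 2i σ_y`. -/
theorem stmt11 (γ : ℝ) (hγ : γ ^ 2 < 1) :
    let sx : Matrix (Fin 2) (Fin 2) ℂ :=
      ((Real.sqrt (1 - γ ^ 2) : ℂ))⁻¹ •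
        !![-Complex.I * γ, 1; 1, Complex.I * γ]
    let sy : Matrix (Fin 2) (Fin 2) ℂ := !![0, -Complex.I; Complex.I, 0]
    let sz : Matrix (Fin 2) (Fin 2) ℂ :=
      ((Real.sqrt (1 - γ ^ 2) : ℂ))⁻¹ •
        !![1, Complex.I * γ; Complex.I * γ, -1]
    sx * sy - sy * sx = (2 * Complex.I) • sz ∧
    sy * sz - sz * sy = (2 * Complex.I) • sx ∧
    sz * sx - sx * sz = (2 * Complex.I) • sy := by
  intro sx sy sz
  have hpos : 0 < 1 - γ ^ 2 := by linarith
  have hs : (Real.sqrt (1 - γ ^ 2) : ℂ) ^ 2 = 1 - (γ : ℂ) ^ 2 := by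
    rw [← Complex.ofReal_pow, Real.sq_sqrt hpos.le]
    push_cast
    rfl
  have hs0 : (Real.sqrt (1 - γ ^ 2) : ℂ) ≠ 0 :=
    Complex.ofReal_ne_zero.mpr (Real.sqrt_pos.mpr hpos).ne'
  have hc : ((Real.sqrt (1 - γ ^ 2) : ℂ))⁻¹ ^ 2 * (1 - (γ : ℂ) ^ 2) = 1 := by
    rw [← hs, ← mul_pow, inv_mul_cancel₀ hs0, one_pow]
  have hI : Complex.I ^ 2 = -1 := Complex.I_sq
  simp only [sx, sy, sz]
  generalize ((Real.sqrt (1 - γ ^ 2) : ℂ))⁻¹ = c at hc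
  generalize (γ : ℂ) = g at hc
  generalize Complex.I = j at hI
  refine ⟨?_, ?_, ?_⟩ <;> ext a b <;> fin_cases a <;> fin_cases b <;>
    simp [Matrix.mul_apply, Fin.sum_univ_two] <;> grind
end
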